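/- arXiv:1101.4974 — 7 statements merged into one kernel-verified Lean document; each statement's English description precedes it below -/
import Mathlib

section
/- For every Schwartz function h : ℝ → ℂ, the function S(h)(t) = −h(t) + ∫₀^∞ e^{−s/2} h(t−s) ds satisfies, for all λ ∈ ℝ: ∫_ℝ e^{−iλt} (S h)(t) dt = exp(−2i·arctan(2λ)) · ĥ(λ), where ĥ(λ) = ∫_ℝ e^{−iλt} h(t) dt. -/
open MeasureTheory

/-- The Cayley transform of `i x` in terms of `arctan`. -/
lemma exp_neg_two_I_arctan_mul (x : ℝ) :
    Complex.exp (-2 * Complex.I * Real.arctan x) * (1 + Complex.I * x) = 1 - Complex.I * x := by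
  have hc : (Real.cos (Real.arctan x) : ℂ) ≠ 0 :=
    Complex.ofReal_ne_zero.mpr (Real.cos_arctan_pos x).ne'
  have hs : (Real.sin (Real.arctan x) : ℂ) = x * Real.cos (Real.arctan x) := by
    rw [← Complex.ofReal_mul, ← Real.tan_mul_cos (Real.cos_arctan_pos x).ne', Real.tan_arctan]
  have hpos : Complex.exp (Real.arctan x * Complex.I)
      = Real.cos (Real.arctan x) * (1 + Complex.I * x) := by
    rw [Complex.exp_mul_I, ← Complex.ofReal_cos, ← Complex.ofReal_sin, hs]
    ring
  have hneg : Complex.exp (-Real.arctan x * Complex.I)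
      = Real.cos (Real.arctan x) * (1 - Complex.I * x) := by
    rw [Complex.exp_mul_I, Complex.cos_neg, Complex.sin_neg, ← Complex.ofReal_cos,
      ← Complex.ofReal_sin, hs]
    ring
  apply mul_left_cancel₀ hc
  rw [← hneg, mul_left_comm, ← hpos, ← Complex.exp_add]
  ring_nf

lemma integrable_exp_neg_I_mul {μ : Measure ℝ} {f : ℝ → ℂ} (hf : Integrable f μ) (l : ℝ) :
    Integrable (fun t : ℝ ↦ Complex.exp (-Complex.I * l * t) * f t) μ := by
  refine hf.bdd_mul (c := 1) (by fun_prop) (Filter.Eventually.of_forall fun t ↦ ?_)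
  simp [Complex.norm_exp]

/-- The Fourier transform of a convolution with a function supported on the half-line, together
with the integrability of its integrand. -/
lemma integrable_and_integral_exp_mul_halfLine_convolution {k g : ℝ → ℂ}
    (hk : IntegrableOn k (Set.Ioi 0)) (hg : Integrable g) (l : ℝ) :
    Integrable (fun t : ℝ ↦ Complex.exp (-Complex.I * l * t) *
        ∫ s in Set.Ioi (0 : ℝ), k s * g (t - s)) ∧
      ∫ t : ℝ, Complex.exp (-Complex.I * l * t) * ∫ s in Set.Ioi (0 : ℝ), k s * g (t - s)
        = (∫ s in Set.Ioi (0 : ℝ), Complex.exp (-Complex.I * l * s) * k s) *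
            ∫ t : ℝ, Complex.exp (-Complex.I * l * t) * g t := by
  have hF := (integrable_indicator_iff measurableSet_Ioi).mpr (integrable_exp_neg_I_mul hk l)
  have hG := integrable_exp_neg_I_mul hg l
  have hconv : (fun t : ℝ ↦ Complex.exp (-Complex.I * l * t) *
      ∫ s in Set.Ioi (0 : ℝ), k s * g (t - s)) =
      convolution ((Set.Ioi 0).indicator fun s : ℝ ↦ Complex.exp (-Complex.I * l * s) * k s)
        (fun t : ℝ ↦ Complex.exp (-Complex.I * l * t) * g t)
        (ContinuousLinearMap.mul ℝ ℂ) volume := by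
    funext t
    rw [convolution_def, ← integral_const_mul, ← integral_indicator measurableSet_Ioi]
    congr 1
    funext s
    by_cases hs : s ∈ Set.Ioi (0 : ℝ)
    · have hexp : Complex.exp (-Complex.I * l * t)
          = Complex.exp (-Complex.I * l * s) * Complex.exp (-Complex.I * l * (t - s : ℝ)) := by
        rw [← Complex.exp_add]
        push_cast
        ring_nf
      simp only [Set.indicator_of_mem hs, ContinuousLinearMap.mul_apply', hexp]
      ring
    · simp [Set.indicator_of_notMem hs]
  rw [hconv]
  refine ⟨hF.integrable_convolution _ hG, ?_⟩
  rw [integral_convolution _ hF hG, integral_indicator measurableSet_Ioi,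
    ContinuousLinearMap.mul_apply']

/-- The Fourier transform of `e^{-s/2}` on the half-line. -/
lemma integral_Ioi_exp_mul_exp_neg_half (l : ℝ) :
    ∫ s in Set.Ioi (0 : ℝ), Complex.exp (-Complex.I * l * s) * Complex.exp (-(s : ℂ) / 2)
      = 2 / (1 + Complex.I * (2 * l : ℝ)) := by
  have hre : (-(1 / 2 + Complex.I * l)).re < 0 := by simp
  have hne : 1 + Complex.I * (2 * l : ℝ) ≠ 0 := fun h ↦ by simpa using congrArg Complex.re h
  have hne' : -(1 / 2 + Complex.I * l) ≠ 0 := fun h ↦ by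
    rw [h] at hre
    exact lt_irrefl _ hre
  calc _ = ∫ s in Set.Ioi (0 : ℝ), Complex.exp (-(1 / 2 + Complex.I * l) * s) := by
        congr 1
        funext s
        rw [← Complex.exp_add]
        ring_nf
    _ = 2 / (1 + Complex.I * (2 * l : ℝ)) := by
        rw [integral_exp_mul_complex_Ioi hre, div_eq_div_iff hne' hne]
        push_cast
        simp
        ring

/-- The Fourier multiplier of the Jeulin–Yor operator
`S(h)(t) = -h(t) + ∫₀^∞ e^{-s/2} h(t-s) ds` is `e^{-2i arctan(2λ)}`:
for every Schwartz `h : ℝ → ℂ` and every `λ ∈ ℝ`,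
`∫_ℝ e^{-iλt} (Sh)(t) dt = exp(-2i arctan(2λ)) · ĥ(λ)`. -/
theorem fourier_multiplier_S (h : SchwartzMap ℝ ℂ)
    (Sh : ℝ → ℂ)
    (hSh : ∀ t : ℝ, Sh t = -h t + ∫ s in Set.Ioi (0 : ℝ),
        Complex.exp (-(s : ℂ) / 2) * h (t - s))
    (l : ℝ) :
    ∫ t : ℝ, Complex.exp (-Complex.I * l * t) * Sh t
      = Complex.exp (-2 * Complex.I * Real.arctan (2 * l)) *
          ∫ t : ℝ, Complex.exp (-Complex.I * l * t) * h t := by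
  have hk : IntegrableOn (fun s : ℝ ↦ Complex.exp (-(s : ℂ) / 2)) (Set.Ioi 0) := by
    convert integrableOn_exp_mul_complex_Ioi (a := -(1 / 2)) (by simp) 0 using 3
    ring
  obtain ⟨hint, heq⟩ :=
    integrable_and_integral_exp_mul_halfLine_convolution hk h.integrable l
  have hne : 1 + Complex.I * (2 * l : ℝ) ≠ 0 := fun h ↦ by simpa using congrArg Complex.re h
  have hmult : Complex.exp (-2 * Complex.I * Real.arctan (2 * l))
      = -1 + 2 / (1 + Complex.I * (2 * l : ℝ)) := by
    rw [eq_div_of_mul_eq hne (exp_neg_two_I_arctan_mul (2 * l))]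
    field_simp
    ring
  simp only [hSh, mul_add, mul_neg]
  rw [integral_add (integrable_exp_neg_I_mul h.integrable l).fun_neg hint, integral_neg, heq,
    integral_Ioi_exp_mul_exp_neg_half, hmult]
  ring
end

section
/- For every Schwartz function h : ℝ → ℝ, the function S(h)(t) = −h(t) + ∫₀^∞ e^{−s/2} h(t−s) ds satisfies ∫_ℝ ( (Sh)(t)²/4 + (Sh)'(t)² ) dt = ∫_ℝ ( h(t)²/4 + h'(t)² ) dt. -/
open MeasureTheory

/-- The causal exponential average `t ↦ ∫₀^∞ e^{-s/2} f(t-s) ds`. -/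
noncomputable def expAverage (f : ℝ → ℝ) (t : ℝ) : ℝ :=
  ∫ s in Set.Ioi (0 : ℝ), Real.exp (-s / 2) * f (t - s)

theorem integrableOn_exp_neg_div_two :
    IntegrableOn (fun s : ℝ => Real.exp (-s / 2)) (Set.Ioi 0) := by
  have h := integrableOn_exp_mul_Ioi (a := -1 / 2) (by norm_num) 0
  refine h.congr_fun (fun s _ => ?_) measurableSet_Ioi
  ring_nf

theorem integrable_expAverage {f : ℝ → ℝ} (hf : Integrable f) :
    Integrable (expAverage f) := by
  have hk : Integrable ((Set.Ioi (0 : ℝ)).indicator fun s : ℝ => Real.exp (-s / 2)) :=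
    (integrable_indicator_iff measurableSet_Ioi).2 integrableOn_exp_neg_div_two
  refine (hk.integrable_convolution (ContinuousLinearMap.mul ℝ ℝ) hf).congr (.of_forall fun t => ?_)
  rw [expAverage, ← integral_indicator measurableSet_Ioi]
  refine integral_congr_ae (.of_forall fun s => ?_)
  by_cases hs : s ∈ Set.Ioi (0 : ℝ) <;> simp [hs]

theorem norm_expAverage_le {f : ℝ → ℝ} {C : ℝ} (hC : ∀ t, ‖f t‖ ≤ C) (t : ℝ) :
    ‖expAverage f t‖ ≤ ∫ s in Set.Ioi (0 : ℝ), Real.exp (-s / 2) * C := by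
  refine norm_integral_le_of_norm_le (integrableOn_exp_neg_div_two.mul_const C)
    (.of_forall fun s => ?_)
  rw [norm_mul, Real.norm_of_nonneg (Real.exp_pos _).le]
  gcongr
  exact hC _

theorem expAverage_eq_exp_mul_integral_Iio (f : ℝ → ℝ) (t : ℝ) :
    expAverage f t = Real.exp (-t / 2) * ∫ u in Set.Iio t, Real.exp (u / 2) * f u := by
  rw [expAverage, ← integral_const_mul, ← integral_indicator measurableSet_Ioi,
    ← integral_indicator measurableSet_Iio, ← integral_sub_left_eq_self _ volume t]
  refine integral_congr_ae (.of_forall fun s => ?_)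
  by_cases hs : s < t
  · simp only [Set.indicator, Set.mem_Ioi, Set.mem_Iio, sub_pos, hs, if_true, sub_sub_cancel,
      ← mul_assoc, ← Real.exp_add]
    ring_nf
  · simp [Set.indicator, hs]

theorem hasDerivAt_expAverage {f : ℝ → ℝ} (hf : Integrable f) (hcont : Continuous f) (t : ℝ) :
    HasDerivAt (expAverage f) (f t - expAverage f t / 2) t := by
  have hint (a : ℝ) : IntegrableOn (fun u => Real.exp (u / 2) * f u) (Set.Iic a) := by
    refine hf.integrableOn.bdd_mul (c := Real.exp (a / 2)) (by fun_prop) ?_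
    filter_upwards [ae_restrict_mem measurableSet_Iic] with u hu
    rw [Real.norm_of_nonneg (Real.exp_pos _).le]
    gcongr
    exact hu
  have heq : expAverage f = fun a => Real.exp (-a / 2) *
      ((∫ u in Set.Iic 0, Real.exp (u / 2) * f u) + ∫ u in 0..a, Real.exp (u / 2) * f u) := by
    funext a
    rw [expAverage_eq_exp_mul_integral_Iio, ← integral_Iic_eq_integral_Iio,
      ← intervalIntegral.integral_Iic_sub_Iic (hint 0) (hint a), add_sub_cancel]
  have hF := (show Continuous fun u => Real.exp (u / 2) * f u by fun_prop).integral_hasStrictDerivAt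
    0 t |>.hasDerivAt.const_add (∫ u in Set.Iic 0, Real.exp (u / 2) * f u)
  have hE := ((hasDerivAt_id t).neg.div_const 2).exp
  rw [heq]
  refine (hE.mul hF).congr_deriv ?_
  have hone : Real.exp (-t / 2) * Real.exp (t / 2) = 1 := by
    rw [← Real.exp_add]; simp [neg_div]
  simp only [Pi.neg_apply, id]
  linear_combination f t * hone

/-- The Jeulin–Yor operator `S(h)(t) = -h(t) + ∫₀^∞ e^{-s/2} h(t-s) ds`
is an isometry for the `H^U` norm: for every Schwartz `h : ℝ → ℝ`,
`∫_ℝ ((Sh)(t)²/4 + (Sh)'(t)²) dt = ∫_ℝ (h(t)²/4 + h'(t)²) dt`. -/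
theorem S_isometry_HU (h : SchwartzMap ℝ ℝ)
    (Sh : ℝ → ℝ)
    (hSh : ∀ t : ℝ, Sh t = -h t + ∫ s in Set.Ioi (0 : ℝ),
        Real.exp (-s / 2) * h (t - s)) :
    ∫ t : ℝ, ((Sh t) ^ 2 / 4 + (deriv Sh t) ^ 2)
      = ∫ t : ℝ, ((h t) ^ 2 / 4 + (deriv (⇑h) t) ^ 2) := by
  set g := expAverage h
  set dh := SchwartzMap.derivCLM ℝ ℝ h
  have hh_deriv (t : ℝ) : HasDerivAt h (dh t) t := h.hasDerivAt t
  have hg_deriv (t : ℝ) : HasDerivAt g (h t - g t / 2) t :=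
    hasDerivAt_expAverage h.integrable h.continuous t
  have hSh_eq : Sh = fun t => -h t + g t := funext hSh
  have hSh_deriv (t : ℝ) : deriv Sh t = -dh t + (h t - g t / 2) := by
    rw [hSh_eq]
    exact ((hh_deriv t).neg.add (hg_deriv t)).deriv
  have hg_int : Integrable g := integrable_expAverage h.integrable
  have hgg : Integrable fun t => g t * g t :=
    hg_int.bdd_mul hg_int.1 (.of_forall (norm_expAverage_le (h.norm_le_seminorm ℝ)))
  have hmul_schwartz {u : ℝ → ℝ} (hu : Integrable u) (k : SchwartzMap ℝ ℝ) :
      Integrable fun t => u t * k t :=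
    hu.mul_bdd k.continuous.aestronglyMeasurable (.of_forall (k.norm_le_seminorm ℝ))
  have hgh := hmul_schwartz hg_int h
  have hgd := hmul_schwartz hg_int dh
  have hhh := hmul_schwartz h.integrable h
  have hhd := hmul_schwartz h.integrable dh
  have hdd := hmul_schwartz dh.integrable dh
  -- The difference of the two integrands is the derivative of `-g²/2 + gh - h²`.
  have hD_int : Integrable fun t => g t * g t / 2 - 3 / 2 * (g t * h t) + h t * h t
      - 2 * (h t * dh t) + g t * dh t :=
    ((((hgg.div_const 2).sub (hgh.const_mul _)).add hhh).sub (hhd.const_mul 2)).add hgd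
  have hzero := integral_eq_zero_of_hasDerivAt_of_integrable
    (f := fun t => -(g t * g t) / 2 + g t * h t - h t * h t)
    (fun t => (((((hg_deriv t).mul (hg_deriv t)).neg.div_const 2).add
      ((hg_deriv t).mul (hh_deriv t))).sub
      ((hh_deriv t).mul (hh_deriv t))).congr_deriv (by ring)) hD_int
    (((hgg.neg.div_const 2).add hgh).sub hhh)
  have hR_int : Integrable fun t => (h t) ^ 2 / 4 + (deriv (⇑h) t) ^ 2 := by
    simp only [pow_two]
    exact (hhh.div_const 4).add hdd
  rw [← add_zero (∫ t : ℝ, ((h t) ^ 2 / 4 + (deriv (⇑h) t) ^ 2)), ← hzero,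
    ← integral_add hR_int hD_int]
  refine integral_congr_ae (.of_forall fun t => ?_)
  simp only [hSh_deriv, (hh_deriv t).deriv]
  rw [hSh_eq]
  ring
end

section
/- For u ∈ ℝ define 𝒮^u φ = ℱ^{−1}( λ ↦ exp(−2iu·arctan(2λ)) · (ℱφ)(λ) ) for Schwartz φ : ℝ → ℂ, where ℱ denotes the Fourier transform (convention (ℱφ)(λ) = ∫_ℝ e^{−iλt} φ(t) dt) and ℱ^{−1} its inverse. Then for all u, v ∈ ℝ and all Schwartz φ, 𝒮^{u+v} φ = 𝒮^u ( 𝒮^v φ ) as functions on ℝ. In particular 𝒮¹ coincides with the Jeulin–Yor operator S(φ)(t) = −φ(t) + ∫₀^∞ e^{−s/2} φ(t−s) ds. -/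
open MeasureTheory
open scoped FourierTransform Convolution SchwartzMap

theorem iteratedDeriv_cexp_const_mul_ofReal (c : ℂ) (n : ℕ) :
    iteratedDeriv n (fun x : ℝ => Complex.exp (c * x)) =
      fun x : ℝ => c ^ n * Complex.exp (c * x) := by
  induction n with
  | zero => simp
  | succ n ih =>
    rw [iteratedDeriv_succ, ih]
    ext x
    have h : HasDerivAt (fun x : ℝ => c * (x : ℂ)) c x := by
      simpa using (Complex.ofRealCLM.hasDerivAt (x := x)).const_mul c
    rw [(h.cexp.const_mul (c ^ n)).deriv]
    ring

theorem hasTemperateGrowth_cexp_ofReal_mul_I (a : ℝ) :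
    (fun x : ℝ => Complex.exp ((a * Complex.I) * x)).HasTemperateGrowth := by
  refine ⟨(contDiff_const.mul Complex.ofRealCLM.contDiff).cexp, fun n => ⟨0, |a| ^ n, fun x => ?_⟩⟩
  rw [norm_iteratedFDeriv_eq_norm_iteratedDeriv, iteratedDeriv_cexp_const_mul_ofReal]
  have h : Complex.exp (a * Complex.I * x) = Complex.exp ((a * x : ℝ) * Complex.I) := by
    push_cast; ring_nf
  simp only [h, norm_mul, Complex.norm_exp_ofReal_mul_I]
  simp

theorem hasTemperateGrowth_arctan : Real.arctan.HasTemperateGrowth := by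
  refine .of_fderiv (k := 0) (C := Real.pi / 2) ?_ Real.differentiable_arctan fun x => ?_
  · have h : fderiv ℝ Real.arctan = fun x : ℝ =>
        ContinuousLinearMap.toSpanSingletonCLE (𝕜 := ℝ) (E := ℝ) ((1 + ‖x‖ ^ 2) ^ (-1 : ℝ)) := by
      ext x
      simp [Real.rpow_neg_one]
    rw [h]
    exact (ContinuousLinearEquiv.hasTemperateGrowth _).comp
      (Function.hasTemperateGrowth_one_add_norm_sq_rpow ℝ (-1))
  · simpa using abs_le.2 ⟨(Real.neg_pi_div_two_lt_arctan x).le, (Real.arctan_lt_pi_div_two x).le⟩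

/-- The symbol `e^{-2iu arctan(2λ)}` at `λ = 2πξ`. -/
noncomputable def arctanSymbol (u ξ : ℝ) : ℂ :=
  Complex.exp (-2 * Complex.I * u * Real.arctan (2 * (2 * Real.pi * ξ)))

theorem arctanSymbol_hasTemperateGrowth (u : ℝ) : (arctanSymbol u).HasTemperateGrowth := by
  have h : arctanSymbol u = (fun x : ℝ => Complex.exp (((-2 * u : ℝ) * Complex.I) * x)) ∘
      (Real.arctan ∘ fun ξ : ℝ => (2 * (2 * Real.pi)) * ξ) := by
    ext ξ
    simp only [arctanSymbol, Function.comp_apply]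
    push_cast
    ring_nf
  rw [h]
  exact (hasTemperateGrowth_cexp_ofReal_mul_I _).comp
    (hasTemperateGrowth_arctan.comp (by fun_prop))

theorem arctanSymbol_add (u v : ℝ) :
    arctanSymbol (u + v) = arctanSymbol u * arctanSymbol v := by
  ext ξ
  simp only [arctanSymbol, Pi.mul_apply, ← Complex.exp_add]
  push_cast
  ring_nf

theorem cexp_neg_two_I_mul_arctan (x : ℝ) :
    Complex.exp (-2 * Complex.I * Real.arctan x) =
      (1 - Complex.I * x) / (1 + Complex.I * x) := by
  have hx : (1 + Complex.I * x : ℂ) ≠ 0 := fun h => by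
    simpa using congrArg Complex.re h
  have hc : ((Real.cos (Real.arctan x) : ℝ) : ℂ) ^ 2 * (1 + (x : ℂ) ^ 2) = 1 := by
    have : Real.cos (Real.arctan x) ^ 2 * (1 + x ^ 2) = 1 := by
      rw [Real.cos_sq_arctan]
      field_simp
    exact_mod_cast this
  have hs : Real.sin (Real.arctan x) = x * Real.cos (Real.arctan x) := by
    rw [Real.sin_arctan, Real.cos_arctan]
    ring
  have he : Complex.exp (-2 * Complex.I * Real.arctan x) =
      (Real.cos (Real.arctan x) - Real.sin (Real.arctan x) * Complex.I) ^ 2 := by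
    have h : (-2 * Complex.I * Real.arctan x : ℂ) =
        ((2 : ℕ) : ℂ) * ((-Real.arctan x : ℝ) * Complex.I) := by
      push_cast; ring
    rw [h, Complex.exp_nat_mul, Complex.exp_mul_I, ← Complex.ofReal_cos, ← Complex.ofReal_sin,
      Real.cos_neg, Real.sin_neg]
    push_cast
    ring
  rw [he, hs, eq_div_iff hx]
  push_cast [-Complex.ofReal_cos] at hc ⊢
  linear_combination (1 - Complex.I * x) * hc - ((Real.cos (Real.arctan x) : ℝ) : ℂ) ^ 2 *
    (x : ℂ) ^ 2 * (1 - Complex.I * x) * Complex.I_sq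

/-- The density `e^{-s/2}` on the positive half-line. -/
noncomputable def expKernel : ℝ → ℂ :=
  (Set.Ioi (0 : ℝ)).indicator fun s => Complex.exp (-(s : ℂ) / 2)

theorem integrable_expKernel : Integrable expKernel := by
  rw [expKernel, integrable_indicator_iff measurableSet_Ioi]
  refine (integrableOn_exp_mul_complex_Ioi (a := -1 / 2) (by norm_num) 0).congr_fun
    (fun s _ => ?_) measurableSet_Ioi
  simp only
  ring_nf

theorem fourier_expKernel (ξ : ℝ) : 𝓕 expKernel ξ = arctanSymbol 1 ξ + 1 := by
  have hint : 𝓕 expKernel ξ =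
      ∫ s in Set.Ioi (0 : ℝ), Complex.exp ((-1 / 2 - 2 * Real.pi * ξ * Complex.I) * s) := by
    rw [Real.fourier_real_eq_integral_exp_smul, ← integral_indicator measurableSet_Ioi]
    refine integral_congr_ae (.of_forall fun s => ?_)
    by_cases hs : s ∈ Set.Ioi (0 : ℝ)
    · simp only [expKernel, Set.indicator_of_mem hs, smul_eq_mul, ← Complex.exp_add]
      push_cast
      ring_nf
    · simp [expKernel, Set.indicator_of_notMem hs]
  have hne : (1 + Complex.I * ((2 * (2 * Real.pi * ξ) : ℝ) : ℂ)) ≠ 0 := fun h => by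
    simpa using congrArg Complex.re h
  have hne' : (-1 / 2 - 2 * Real.pi * ξ * Complex.I : ℂ) ≠ 0 := fun h => hne <| by
    push_cast
    linear_combination (-2) * h
  rw [hint, integral_exp_mul_complex_Ioi (by norm_num), arctanSymbol]
  have := cexp_neg_two_I_mul_arctan (2 * (2 * Real.pi * ξ))
  rw [Complex.ofReal_one, mul_one, this, div_add_one hne, div_eq_div_iff hne' hne]
  push_cast
  simp only [mul_zero, Complex.exp_zero]
  ring

theorem inverse_fourier_angular_eq (m f : ℝ → ℂ) (t : ℝ) :
    (1 / (2 * Real.pi) : ℂ) * ∫ l : ℝ, Complex.exp (Complex.I * l * t) *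
        (m l * ∫ x : ℝ, Complex.exp (-Complex.I * l * x) * f x) =
      𝓕⁻ (fun ξ => m (2 * Real.pi * ξ) * 𝓕 f ξ) t := by
  have h := Measure.integral_comp_mul_left (fun l : ℝ => Complex.exp (Complex.I * l * t) *
        (m l * ∫ x : ℝ, Complex.exp (-Complex.I * l * x) * f x)) (2 * Real.pi)
  rw [abs_of_pos (by positivity), Complex.real_smul] at h
  rw [one_div]
  push_cast at h
  rw [← h, Real.fourierInv_eq']
  refine integral_congr_ae (.of_forall fun ξ => ?_)
  simp only [Real.fourier_real_eq_integral_exp_smul, smul_eq_mul]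
  congr 1
  · simp
    ring_nf
  · congr 1
    refine integral_congr_ae (.of_forall fun x => ?_)
    simp only
    push_cast
    ring_nf

theorem fourierInv_arctanSymbol_mul_fourier (u : ℝ) (φ : 𝓢(ℝ, ℂ)) :
    𝓕⁻ (fun ξ => arctanSymbol u ξ * 𝓕 (φ : ℝ → ℂ) ξ) =
      ⇑(SchwartzMap.fourierMultiplierCLM ℂ (arctanSymbol u) φ) := by
  rw [SchwartzMap.fourierMultiplierCLM_apply, SchwartzMap.fourierInv_coe]
  congr 1
  ext ξ
  rw [SchwartzMap.smulLeftCLM_apply_apply (arctanSymbol_hasTemperateGrowth u),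
    SchwartzMap.fourier_coe, smul_eq_mul]

theorem convolution_expKernel (φ : 𝓢(ℝ, ℂ)) :
    expKernel ⋆[ContinuousLinearMap.mul ℂ ℂ] ⇑φ =
      ⇑(SchwartzMap.fourierMultiplierCLM ℂ (arctanSymbol 1) φ + φ) := by
  set ψ := SchwartzMap.fourierMultiplierCLM ℂ (arctanSymbol 1) φ with hψ
  have hF : 𝓕 (expKernel ⋆[ContinuousLinearMap.mul ℂ ℂ] ⇑φ) = ⇑(𝓕 (ψ + φ) : 𝓢(ℝ, ℂ)) := by
    ext ξ
    rw [Real.fourier_mul_convolution_eq integrable_expKernel φ.integrable, fourier_expKernel,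
      FourierTransform.fourier_add, add_apply, hψ,
      SchwartzMap.fourierMultiplierCLM_apply, FourierTransform.fourier_fourierInv_eq,
      SchwartzMap.smulLeftCLM_apply_apply (arctanSymbol_hasTemperateGrowth 1),
      SchwartzMap.fourier_coe, smul_eq_mul]
    ring
  have hcont : Continuous (expKernel ⋆[ContinuousLinearMap.mul ℂ ℂ] ⇑φ) :=
    BddAbove.continuous_convolution_right_of_integrable _
      ⟨SchwartzMap.seminorm ℝ 0 0 φ, fun x ⟨y, hy⟩ => hy ▸ SchwartzMap.norm_le_seminorm ℝ φ y⟩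
      integrable_expKernel φ.continuous
  rw [← hcont.fourierInv_fourier_eq (integrable_expKernel.integrable_convolution _ φ.integrable)
    (hF ▸ (𝓕 (ψ + φ) : 𝓢(ℝ, ℂ)).integrable), hF, ← SchwartzMap.fourierInv_coe,
    FourierTransform.fourierInv_fourier_eq]

/-- The operators `𝒮^u φ = ℱ⁻¹(λ ↦ e^{-2iu arctan(2λ)} (ℱφ)(λ))`, with
Fourier convention `(ℱφ)(λ) = ∫ e^{-iλt} φ(t) dt` and
`(ℱ⁻¹g)(t) = (1/(2π)) ∫ e^{iλt} g(λ) dλ`, form a one-parameter group on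
Schwartz functions, with `𝒮¹` the Jeulin–Yor operator
`S(φ)(t) = -φ(t) + ∫₀^∞ e^{-s/2} φ(t-s) ds`. -/
theorem flow_group_property
    (S : ℝ → (ℝ → ℂ) → (ℝ → ℂ))
    (hS : ∀ (u : ℝ) (φ : ℝ → ℂ) (t : ℝ),
      S u φ t = (1 / (2 * Real.pi)) *
        ∫ l : ℝ, Complex.exp (Complex.I * l * t) *
          (Complex.exp (-2 * Complex.I * u * Real.arctan (2 * l)) *
            ∫ x : ℝ, Complex.exp (-Complex.I * l * x) * φ x))
    (u v : ℝ) (φ : SchwartzMap ℝ ℂ) :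
    (∀ t : ℝ, S (u + v) ⇑φ t = S u (S v ⇑φ) t) ∧
    (∀ t : ℝ, S 1 ⇑φ t
      = -φ t + ∫ s in Set.Ioi (0 : ℝ), Complex.exp (-(s : ℂ) / 2) * φ (t - s)) := by
  have hSφ : ∀ (w : ℝ) (f : 𝓢(ℝ, ℂ)),
      S w f = ⇑(SchwartzMap.fourierMultiplierCLM ℂ (arctanSymbol w) f) := fun w f => by
    ext t
    rw [hS, inverse_fourier_angular_eq
      (fun l => Complex.exp (-2 * Complex.I * w * Real.arctan (2 * l))),
      ← fourierInv_arctanSymbol_mul_fourier]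
    rfl
  refine ⟨fun t => ?_, fun t => ?_⟩
  · rw [hSφ v, hSφ u, hSφ, SchwartzMap.fourierMultiplierCLM_fourierMultiplierCLM_apply
      (arctanSymbol_hasTemperateGrowth u) (arctanSymbol_hasTemperateGrowth v), arctanSymbol_add]
  · have hconv : (expKernel ⋆[ContinuousLinearMap.mul ℂ ℂ] ⇑φ) t =
        ∫ s in Set.Ioi (0 : ℝ), Complex.exp (-(s : ℂ) / 2) * φ (t - s) := by
      rw [convolution_def, ← integral_indicator measurableSet_Ioi]
      refine integral_congr_ae (.of_forall fun s => ?_)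
      by_cases hs : s ∈ Set.Ioi (0 : ℝ)
      · simp [expKernel, Set.indicator_of_mem hs]
      · simp [expKernel, Set.indicator_of_notMem hs]
    rw [← hconv, convolution_expKernel, hSφ, add_apply]
    ring
end

section
/- Let G, H : ℝ → ℂ be measurable with ∫_ℝ |G(λ)|²(1+4λ²) dλ < ∞ and ∫_ℝ |H(λ)|²(1+4λ²) dλ < ∞. Then ∫_ℝ conj(G(λ)) · H(λ) · exp(−2iu·arctan(2λ)) · (1+4λ²) dλ tends to 0 as |u| → ∞ (i.e. both as u → +∞ and as u → −∞). -/
open MeasureTheory Filter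

open scoped FourierTransform in
/-- Riemann–Lebesgue lemma with a phase `φ` that is injective and has nowhere vanishing derivative:
substituting `v = φ x` reduces it to the linear phase. -/
theorem tendsto_integral_exp_phase_smul_cocompact {E : Type*} [NormedAddCommGroup E]
    [NormedSpace ℂ E] {φ φ' : ℝ → ℝ} (hφ : ∀ x, HasDerivAt φ (φ' x) x)
    (hφ' : ∀ x, φ' x ≠ 0) (hinj : Function.Injective φ) (F : ℝ → E) :
    Tendsto (fun u : ℝ => ∫ x : ℝ, 𝐞 (-(φ x * u)) • F x) (cocompact ℝ) (nhds 0) := by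
  have hmeas : MeasurableSet (φ '' Set.univ) :=
    MeasurableSet.univ.image_of_continuousOn_injOn
      (fun x _ => (hφ x).continuousAt.continuousWithinAt) hinj.injOn
  let g : ℝ → E := fun v => |φ' (Function.invFun φ v)|⁻¹ • F (Function.invFun φ v)
  refine (Real.tendsto_integral_exp_smul_cocompact ((φ '' Set.univ).indicator g)).congr fun u => ?_
  have hind : (fun v : ℝ => 𝐞 (-(v * u)) • (φ '' Set.univ).indicator g v) =
      (φ '' Set.univ).indicator (fun v => 𝐞 (-(v * u)) • g v) := by
    ext v
    by_cases hv : v ∈ φ '' Set.univ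
    · simp only [Set.indicator_of_mem hv]
    · simp only [Set.indicator_of_notMem hv, smul_zero]
  rw [hind, integral_indicator hmeas, integral_image_eq_integral_abs_deriv_smul MeasurableSet.univ
    (fun x _ => (hφ x).hasDerivWithinAt) hinj.injOn, setIntegral_univ]
  refine integral_congr_ae (Eventually.of_forall fun x => ?_)
  simp only [g, Function.leftInverse_invFun hinj x]
  rw [smul_comm, smul_inv_smul₀ (abs_ne_zero.mpr (hφ' x))]

/-- The normalized phase `l ↦ arctan (2 l) / π` has derivative `2 / (π (1 + 4 l²))`. -/
theorem hasDerivAt_arctan_two_mul_div_pi (l : ℝ) :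
    HasDerivAt (fun x : ℝ => Real.arctan (2 * x) / Real.pi)
      (1 / (1 + (2 * l) ^ 2) * 2 / Real.pi) l := by
  have h : HasDerivAt (fun x : ℝ => 2 * x) 2 l := by
    simpa using (hasDerivAt_id l).const_mul (2 : ℝ)
  exact h.arctan.div_const _

/-- Riemann–Lebesgue-type decay: if `∫ |G(λ)|²(1+4λ²) dλ < ∞` and
`∫ |H(λ)|²(1+4λ²) dλ < ∞`, then
`∫ conj(G(λ)) H(λ) e^{-2iu arctan(2λ)} (1+4λ²) dλ → 0` as `|u| → ∞`. -/
theorem matrix_coefficients_flow_tendsto_zero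
    (G H : ℝ → ℂ) (hGm : Measurable G) (hHm : Measurable H)
    (hG : Integrable (fun l : ℝ => ‖G l‖ ^ 2 * (1 + 4 * l ^ 2)))
    (hH : Integrable (fun l : ℝ => ‖H l‖ ^ 2 * (1 + 4 * l ^ 2))) :
    Tendsto (fun u : ℝ =>
        ∫ l : ℝ, (starRingEnd ℂ) (G l) * H l *
          Complex.exp (-2 * Complex.I * u * Real.arctan (2 * l)) *
          ((1 : ℂ) + 4 * (l : ℂ) ^ 2))
      atTop (nhds 0) ∧
    Tendsto (fun u : ℝ =>
        ∫ l : ℝ, (starRingEnd ℂ) (G l) * H l *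
          Complex.exp (-2 * Complex.I * u * Real.arctan (2 * l)) *
          ((1 : ℂ) + 4 * (l : ℂ) ^ 2))
      atBot (nhds 0) := by
  have key : Tendsto (fun u : ℝ =>
        ∫ l : ℝ, (starRingEnd ℂ) (G l) * H l *
          Complex.exp (-2 * Complex.I * u * Real.arctan (2 * l)) *
          ((1 : ℂ) + 4 * (l : ℂ) ^ 2))
      (cocompact ℝ) (nhds 0) := by
    refine (tendsto_integral_exp_phase_smul_cocompact hasDerivAt_arctan_two_mul_div_pi
      (fun l => by positivity) (fun x y hxy => ?_)
      (fun l => (starRingEnd ℂ) (G l) * H l * ((1 : ℂ) + 4 * (l : ℂ) ^ 2))).congr fun u => ?_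
    · have h := Real.arctan_injective ((div_left_inj' Real.pi_ne_zero).mp hxy)
      linarith
    · refine integral_congr_ae (Eventually.of_forall fun l => ?_)
      have hphase : ((2 * Real.pi * -(Real.arctan (2 * l) / Real.pi * u) : ℝ) : ℂ) * Complex.I =
          -2 * Complex.I * u * Real.arctan (2 * l) := by
        have hpi : 2 * Real.pi * -(Real.arctan (2 * l) / Real.pi * u) =
            -2 * u * Real.arctan (2 * l) := by
          field_simp
        rw [hpi]
        push_cast
        ring
      simp only [Circle.smul_def, Real.fourierChar_apply, smul_eq_mul, hphase]
      ring
  exact ⟨key.mono_left atTop_le_cocompact, key.mono_left atBot_le_cocompact⟩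
end

section
/- For n ∈ ℕ let L_n(x) = Σ_{k=0}^{n} (n choose k) (−x)^k / k! be the n-th Laguerre polynomial. Then for every n ∈ ℕ and every λ ∈ ℝ, (−1)^n · ( 1 + ∫₀^∞ e^{−x/2} L_n'(x) e^{−iλx} dx ) = ( (1−2iλ)/(1+2iλ) )^n = exp(−2in·arctan(2λ)). -/
open MeasureTheory

/-- A monomial times `exp (-a x)` is integrable on the half-line when `0 < re a`. -/
theorem integrableOn_pow_mul_cexp_neg_mul_Ioi (k : ℕ) {a : ℂ} (ha : 0 < a.re) :
    IntegrableOn (fun x : ℝ ↦ (x : ℂ) ^ k * Complex.exp (-a * x)) (Set.Ioi 0) := by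
  have h := integrableOn_rpow_mul_exp_neg_mul_rpow (s := k) (p := 1) (b := a.re)
    (by have : (0 : ℝ) ≤ k := k.cast_nonneg
        linarith) one_pos ha
  refine h.mono' (by fun_prop) ?_
  refine (ae_restrict_mem measurableSet_Ioi).mono fun x hx ↦ ?_
  have hx : 0 < x := hx
  simp [Complex.norm_exp, abs_of_pos hx]

/-- The Laplace transform of a monomial on the right half-plane. -/
theorem integral_pow_mul_cexp_neg_mul_Ioi (k : ℕ) {a : ℂ} (ha : 0 < a.re) :
    ∫ x in Set.Ioi (0 : ℝ), (x : ℂ) ^ k * Complex.exp (-a * x) =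
      (Nat.factorial k : ℂ) / a ^ (k + 1) := by
  have hne : a ≠ 0 := fun h ↦ by simp [h] at ha
  induction k with
  | zero =>
    simp only [pow_zero, one_mul]
    rw [integral_exp_mul_complex_Ioi (by simpa using ha)]
    simp
  | succ k ih =>
    have hderiv (x : ℝ) : HasDerivAt (fun x : ℝ ↦ (x : ℂ) ^ (k + 1) * Complex.exp (-a * x))
        ((k + 1) * ((x : ℂ) ^ k * Complex.exp (-a * x)) -
          a * ((x : ℂ) ^ (k + 1) * Complex.exp (-a * x))) x := by
      have h : HasDerivAt (fun z : ℂ ↦ z ^ (k + 1) * Complex.exp (-a * z)) _ (x : ℂ) :=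
        (hasDerivAt_pow (k + 1) (x : ℂ)).mul ((hasDerivAt_id (x : ℂ)).const_mul (-a)).cexp
      convert h.comp_ofReal using 1
      push_cast
      simp only [id]
      ring
    have hk := (integrableOn_pow_mul_cexp_neg_mul_Ioi k ha).const_mul ((k : ℂ) + 1)
    have hk' := integrableOn_pow_mul_cexp_neg_mul_Ioi (k + 1) ha
    have hint := hk.sub (hk'.const_mul a)
    have h := integral_Ioi_of_hasDerivAt_of_tendsto' (a := 0) (fun x _ ↦ hderiv x) hint
      (tendsto_zero_of_hasDerivAt_of_integrableOn_Ioi (a := 0) (fun x _ ↦ hderiv x) hint hk')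
    rw [integral_sub hk (hk'.const_mul a), integral_const_mul, integral_const_mul, ih] at h
    simp only [Complex.ofReal_zero, ne_eq, Nat.add_eq_zero_iff, one_ne_zero, and_false,
      not_false_eq_true, zero_pow, zero_mul, sub_zero] at h
    rw [← mul_right_inj' hne, ← sub_eq_zero.mp h, Nat.factorial_succ]
    push_cast
    field_simp
    ring

/-- The derivative of the `n`-th Laguerre polynomial. -/
theorem hasDerivAt_laguerre_sum (n : ℕ) (x : ℝ) :
    HasDerivAt (fun x : ℝ ↦ ∑ k ∈ Finset.range (n + 1),
        (n.choose k : ℝ) * (-x) ^ k / (Nat.factorial k))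
      (∑ k ∈ Finset.range n,
        (n.choose (k + 1) : ℝ) * (-1) ^ (k + 1) / (Nat.factorial k) * x ^ k) x := by
  have h : HasDerivAt (fun x : ℝ ↦ ∑ k ∈ Finset.range (n + 1),
        (n.choose k : ℝ) * (-x) ^ k / (Nat.factorial k))
      (∑ k ∈ Finset.range (n + 1),
        (n.choose k : ℝ) * (k * (-x) ^ (k - 1) * (-1)) / (Nat.factorial k)) x :=
    HasDerivAt.fun_sum fun k _ ↦
      ((((hasDerivAt_id x).neg).pow k).const_mul (n.choose k : ℝ)).div_const _
  convert h using 1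
  rw [Finset.sum_range_succ']
  simp only [Nat.cast_zero, zero_mul, mul_zero, zero_div, add_zero]
  refine Finset.sum_congr rfl fun k _ ↦ ?_
  have hk : (Nat.factorial k : ℝ) ≠ 0 := by positivity
  have hk' : (k : ℝ) + 1 ≠ 0 := by positivity
  rw [Nat.factorial_succ, add_tsub_cancel_right, neg_pow x]
  push_cast
  field_simp
  ring

/-- The Laplace transform of the derivative of the `n`-th Laguerre polynomial. -/
theorem one_add_integral_deriv_laguerre_mul_cexp (n : ℕ) {a : ℂ} (ha : 0 < a.re) :
    1 + ∫ x in Set.Ioi (0 : ℝ),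
        ∑ k ∈ Finset.range n, ((n.choose (k + 1) : ℂ) * (-1) ^ (k + 1) / (Nat.factorial k)) *
          ((x : ℂ) ^ k * Complex.exp (-a * x)) = (1 - 1 / a) ^ n := by
  rw [integral_finsetSum _ fun k _ ↦
    (integrableOn_pow_mul_cexp_neg_mul_Ioi k ha).const_mul _]
  simp only [integral_const_mul, integral_pow_mul_cexp_neg_mul_Ioi _ ha]
  rw [sub_eq_neg_add, add_pow, Finset.sum_range_succ']
  simp only [one_pow, mul_one, pow_zero, Nat.choose_zero_right, Nat.cast_one]
  rw [add_comm]
  congr 1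
  refine Finset.sum_congr rfl fun k _ ↦ ?_
  have hk : (Nat.factorial k : ℂ) ≠ 0 := by exact_mod_cast k.factorial_ne_zero
  rw [neg_pow (1 / a), one_div, inv_pow]
  field_simp

/-- The Cayley transform of a real number on the unit circle, in terms of `arctan`. -/
theorem Complex.one_sub_mul_I_div_one_add_mul_I_eq_exp_arctan (x : ℝ) :
    (1 - x * Complex.I) / (1 + x * Complex.I) =
      Complex.exp (-2 * Complex.I * Real.arctan x) := by
  have hne (y : ℝ) : (1 : ℂ) + y * Complex.I ≠ 0 := fun h ↦ by
    simpa using congrArg Complex.re h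
  have h1 := hne x
  have h2 : (1 : ℂ) - x * Complex.I ≠ 0 := by
    simpa [sub_eq_add_neg] using hne (-x)
  rw [Complex.ofReal_arctan, Complex.arctan]
  rw [show -2 * Complex.I * (-Complex.I / 2 * Complex.log ((1 + x * Complex.I) /
      (1 - x * Complex.I))) = -Complex.log ((1 + x * Complex.I) / (1 - x * Complex.I)) by
    linear_combination (Complex.log ((1 + x * Complex.I) / (1 - x * Complex.I))) * Complex.I_mul_I]
  rw [Complex.exp_neg, Complex.exp_log (div_ne_zero h1 h2), inv_div]

/-- Identification of the convolution powers `μ^{*n}` of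
`μ = -δ₀ + e^{-t/2}𝟙_{t≥0}dt` via Fourier transforms: with `L_n` the `n`-th
Laguerre polynomial, for every `n ∈ ℕ` and `λ ∈ ℝ`,
`(-1)^n (1 + ∫₀^∞ e^{-x/2} L_n'(x) e^{-iλx} dx) = ((1-2iλ)/(1+2iλ))^n
  = exp(-2in arctan(2λ))`. -/
theorem fourier_transform_mu_pow (n : ℕ) (l : ℝ)
    (L : ℝ → ℝ)
    (hL : ∀ x : ℝ, L x = ∑ k ∈ Finset.range (n + 1),
      (n.choose k : ℝ) * (-x) ^ k / (Nat.factorial k)) :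
    ((-1 : ℂ) ^ n *
        (1 + ∫ x in Set.Ioi (0 : ℝ),
          ((Real.exp (-x / 2) * deriv L x : ℝ) : ℂ) * Complex.exp (-Complex.I * l * x))
      = ((1 - 2 * Complex.I * l) / (1 + 2 * Complex.I * l)) ^ n) ∧
    ((1 - 2 * Complex.I * l) / (1 + 2 * Complex.I * l)) ^ n
      = Complex.exp (-2 * Complex.I * n * Real.arctan (2 * l)) := by
  have hre : 0 < ((1 / 2 : ℂ) + Complex.I * l).re := by simp
  have hne : (1 / 2 : ℂ) + Complex.I * l ≠ 0 := fun h ↦ by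
    rw [h] at hre
    simp at hre
  have hne' : (1 : ℂ) + 2 * Complex.I * l ≠ 0 := fun h ↦ hne (by linear_combination h / 2)
  refine ⟨?_, ?_⟩
  · have hint (x : ℝ) :
        ((Real.exp (-x / 2) * deriv L x : ℝ) : ℂ) * Complex.exp (-Complex.I * l * x) =
          ∑ k ∈ Finset.range n, ((n.choose (k + 1) : ℂ) * (-1) ^ (k + 1) / (Nat.factorial k)) *
            ((x : ℂ) ^ k * Complex.exp (-((1 / 2 : ℂ) + Complex.I * l) * x)) := by
      rw [funext hL, (hasDerivAt_laguerre_sum n x).deriv,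
        show -((1 / 2 : ℂ) + Complex.I * l) * x = -x / 2 + -Complex.I * l * x by ring,
        Complex.exp_add]
      push_cast
      rw [Finset.mul_sum, Finset.sum_mul]
      exact Finset.sum_congr rfl fun k _ ↦ by ring
    simp only [hint]
    rw [one_add_integral_deriv_laguerre_mul_cexp n hre, ← mul_pow]
    congr 1
    field_simp
    ring
  · have h := Complex.one_sub_mul_I_div_one_add_mul_I_eq_exp_arctan (2 * l)
    rw [Complex.ofReal_mul, Complex.ofReal_ofNat] at h
    rw [mul_right_comm 2 Complex.I (l : ℂ), h, ← Complex.exp_nat_mul]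
    congr 1
    ring
end

section
/- Fix u ∈ ℝ with u ∉ ℤ. For x ≠ 0 define ψ_u(x) = −(u·sin(πu)/π) · Σ_{k=0}^∞ [ (1 − u·sgn(x))_k · |x|^k / (k!·(k+1)!) ] · [ Γ'/Γ(1+k−u·sgn(x)) − Γ'/Γ(1+k) − Γ'/Γ(2+k) + log|x| ] + sin(πu)/(πx), where (a)_k = a(a+1)···(a+k−1) is the Pochhammer symbol and Γ'/Γ the logarithmic derivative of the gamma function, and set θ_u(x) = e^{−|x|/2} ψ_u(x). Then the series defining ψ_u converges for every x ≠ 0, θ_u is twice differentiable on ℝ \ {0}, and for every x ≠ 0: x·θ_u''(x) + 2·θ_u'(x) + (u − x/4)·θ_u(x) = 0. -/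
open MeasureTheory

/-- The sum of the power series with coefficients `c`. -/
noncomputable def powSum (c : ℕ → ℝ) (t : ℝ) : ℝ := ∑' k, c k * t ^ k

/-- The power series with coefficients `c` converges everywhere. -/
def EntireCoeff (c : ℕ → ℝ) : Prop := ∀ r : ℝ, Summable fun k => c k * r ^ k

/-- The coefficients of the formal derivative. -/
def derivCoeff (c : ℕ → ℝ) (k : ℕ) : ℝ := (k + 1) * c (k + 1)

theorem EntireCoeff.hasSum {c : ℕ → ℝ} (hc : EntireCoeff c) (t : ℝ) :
    HasSum (fun k => c k * t ^ k) (powSum c t) := (hc t).hasSum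

theorem EntireCoeff.of_abs_le {c d : ℕ → ℝ} (hc : EntireCoeff c) (M R : ℝ)
    (h : ∀ k, |d k| ≤ M * |c k| * R ^ k) : EntireCoeff d := by
  intro r
  refine Summable.of_norm_bounded (((hc (R * |r|)).abs).mul_left |M|) fun k => ?_
  rw [Real.norm_eq_abs, abs_mul, abs_mul, abs_pow, abs_pow, abs_mul, abs_abs, mul_pow]
  calc |d k| * |r| ^ k ≤ (M * |c k| * R ^ k) * |r| ^ k := by gcongr; exact h k
    _ ≤ |M * |c k| * R ^ k| * |r| ^ k := by gcongr; exact le_abs_self _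
    _ = _ := by rw [abs_mul, abs_mul, abs_abs, abs_pow]; ring

theorem EntireCoeff.shift {c : ℕ → ℝ} (hc : EntireCoeff c) :
    EntireCoeff fun k => c (k + 1) := by
  intro r
  rcases eq_or_ne r 0 with rfl | hr
  · refine summable_of_ne_finset_zero (s := {0}) fun k hk => ?_
    simp at hk
    simp [hk]
  · refine (((summable_nat_add_iff 1).2 (hc r)).mul_left r⁻¹).congr fun k => ?_
    field_simp
    ring

theorem EntireCoeff.natCast_mul {c : ℕ → ℝ} (hc : EntireCoeff c) :
    EntireCoeff fun k => k * c k := by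
  refine hc.of_abs_le 1 2 fun k => ?_
  rw [abs_mul, Nat.abs_cast, one_mul, mul_comm]
  gcongr
  exact_mod_cast (Nat.lt_two_pow_self).le

theorem EntireCoeff.derivCoeff {c : ℕ → ℝ} (hc : EntireCoeff c) :
    EntireCoeff (derivCoeff c) := by
  intro r
  simpa [_root_.derivCoeff] using hc.natCast_mul.shift r

theorem mul_powSum_shift {c : ℕ → ℝ} (hc : EntireCoeff c) (t : ℝ) :
    t * powSum (fun k => c (k + 1)) t = powSum c t - c 0 := by
  have h := (hc t).tsum_eq_zero_add
  simp only [pow_zero, mul_one] at h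
  rw [powSum, powSum, h, ← tsum_mul_left, add_sub_cancel_left]
  exact tsum_congr fun k => by ring

theorem hasDerivAt_powSum {c : ℕ → ℝ} (hc : EntireCoeff c) (t : ℝ) :
    HasDerivAt (powSum c) (powSum (derivCoeff c) t) t := by
  set R : ℝ := |t| + 1
  have hs : Summable fun k : ℕ => |(k * c k) * R ^ (k - 1)| := by
    rw [← summable_nat_add_iff 1]
    simpa using (hc.natCast_mul.shift R).abs
  have h := hasDerivAt_tsum_of_isPreconnected (g := fun k x => c k * x ^ k)
    (g' := fun k x => (k * c k) * x ^ (k - 1)) (t := Metric.ball 0 R) (y₀ := t) (y := t) hs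
    Metric.isOpen_ball (convex_ball _ _).isPreconnected
    (fun k x _ => ((hasDerivAt_pow k x).const_mul (c k)).congr_deriv (by ring))
    (fun k x hx => by
      rw [Real.norm_eq_abs, abs_mul, abs_mul _ (R ^ _), abs_pow, abs_pow]
      exact mul_le_mul_of_nonneg_left (pow_le_pow_left₀ (abs_nonneg x)
        ((mem_ball_zero_iff.1 hx).le.trans (le_abs_self R)) _) (abs_nonneg _))
    (by simp [R]) (hc t) (by simp [R])
  have hs' : Summable fun k : ℕ => (k * c k) * t ^ (k - 1) := by
    rw [← summable_nat_add_iff 1]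
    simpa using hc.natCast_mul.shift t
  rw [hs'.tsum_eq_zero_add] at h
  refine h.congr_deriv ?_
  simp [powSum, derivCoeff]

/-- Kummer's operator `t y'' + (2 - t) y' - a y` applied termwise to a power series. -/
theorem kummer_powSum {p : ℕ → ℝ} (hp : EntireCoeff p) (a t : ℝ) :
    t * powSum (derivCoeff (derivCoeff p)) t + (2 - t) * powSum (derivCoeff p) t - a * powSum p t
      = powSum (fun k => (k + 1) * (k + 2) * p (k + 1) - (k + a) * p k) t := by
  have h₁ := mul_powSum_shift hp.derivCoeff.natCast_mul t
  have h₂ := mul_powSum_shift hp.natCast_mul t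
  have e₁ : (fun k : ℕ => ((k + 1 : ℕ) : ℝ) * derivCoeff p (k + 1))
      = derivCoeff (derivCoeff p) := by
    funext k; simp [derivCoeff]
  have e₂ : (fun k : ℕ => ((k + 1 : ℕ) : ℝ) * p (k + 1)) = derivCoeff p := by
    funext k; simp [derivCoeff]
  rw [e₁] at h₁
  rw [e₂] at h₂
  simp only [Nat.cast_zero, zero_mul, sub_zero] at h₁ h₂
  rw [sub_mul, h₁, h₂]
  have H := (((hp.derivCoeff.natCast_mul.hasSum t).add
    (((hp.derivCoeff.hasSum t).mul_left 2).sub (hp.natCast_mul.hasSum t))).sub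
    ((hp.hasSum t).mul_left a)).tsum_eq
  rw [← H]
  exact tsum_congr fun k => by simp only [derivCoeff]; ring

theorem logDeriv_Gamma_add_one {y : ℝ} (hy : ∀ m : ℕ, y ≠ -m) :
    deriv Real.Gamma (y + 1) / Real.Gamma (y + 1)
      = deriv Real.Gamma y / Real.Gamma y + 1 / y := by
  have hy0 : y ≠ 0 := by simpa using hy 0
  have hy1 : ∀ m : ℕ, y + 1 ≠ -m := fun m h => hy (m + 1) (by push_cast; linarith)
  have hG := Real.Gamma_ne_zero hy
  have h₁ : HasDerivAt (fun z => Real.Gamma (z + 1)) (deriv Real.Gamma (y + 1)) y :=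
    (Real.differentiableAt_Gamma hy1).hasDerivAt.comp_add_const y 1
  have h₂ : HasDerivAt (fun z => z * Real.Gamma z)
      (1 * Real.Gamma y + y * deriv Real.Gamma y) y :=
    (hasDerivAt_id y).mul (Real.differentiableAt_Gamma hy).hasDerivAt
  have h₃ : (fun z => Real.Gamma (z + 1)) =ᶠ[nhds y] fun z => z * Real.Gamma z := by
    filter_upwards [isOpen_ne.mem_nhds hy0] with z hz using Real.Gamma_add_one hz
  rw [h₁.unique (h₂.congr_of_eventuallyEq h₃), Real.Gamma_add_one hy0]
  field_simp
  ring

/-- The Taylor coefficients of Kummer's function `M(a, 2, ·)`. -/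
noncomputable def kummerCoeff (a : ℝ) (k : ℕ) : ℝ :=
  (ascPochhammer ℝ k).eval a / ((Nat.factorial k : ℝ) * (Nat.factorial (k + 1) : ℝ))

theorem kummerCoeff_succ (a : ℝ) (k : ℕ) :
    (k + 1) * (k + 2) * kummerCoeff a (k + 1) = (k + a) * kummerCoeff a k := by
  have h₁ : (Nat.factorial k : ℝ) ≠ 0 := by positivity
  have h₂ : (k : ℝ) + 1 ≠ 0 := by positivity
  have h₃ : (k : ℝ) + 1 + 1 ≠ 0 := by positivity
  simp only [kummerCoeff, ascPochhammer_succ_eval, Nat.factorial_succ, Nat.cast_mul, Nat.cast_add,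
    Nat.cast_one]
  field_simp
  ring

theorem entireCoeff_kummerCoeff (a : ℝ) : EntireCoeff (kummerCoeff a) := by
  intro r
  refine summable_of_ratio_norm_eventually_le (r := 1 / 2) (by norm_num) ?_
  obtain ⟨N, hN⟩ := exists_nat_ge (2 * (1 + |a|) * |r|)
  filter_upwards [Filter.eventually_ge_atTop N] with k hk
  have hk' : 2 * (1 + |a|) * |r| ≤ k := hN.trans (by exact_mod_cast hk)
  have hpos : 0 < ((k : ℝ) + 1) * (k + 2) := by positivity
  have hsucc : kummerCoeff a (k + 1) = (k + a) / ((k + 1) * (k + 2)) * kummerCoeff a k := by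
    rw [div_mul_eq_mul_div, eq_div_iff hpos.ne', ← kummerCoeff_succ]
    ring
  have hka : |k + a| ≤ (k + 1) * (1 + |a|) := by
    have := abs_add_le (k : ℝ) a
    rw [Nat.abs_cast] at this
    nlinarith [abs_nonneg a, (Nat.cast_nonneg k : (0 : ℝ) ≤ k)]
  have hle : |k + a| / ((k + 1) * (k + 2)) * |r| ≤ 1 / 2 := by
    rw [div_mul_eq_mul_div, div_le_iff₀ hpos]
    have := mul_le_mul_of_nonneg_right hka (abs_nonneg r)
    nlinarith [(Nat.cast_nonneg k : (0 : ℝ) ≤ k)]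
  calc ‖kummerCoeff a (k + 1) * r ^ (k + 1)‖
      = (|k + a| / ((k + 1) * (k + 2)) * |r|) * ‖kummerCoeff a k * r ^ k‖ := by
        rw [hsucc, pow_succ]
        simp only [Real.norm_eq_abs, abs_mul (_ / _), abs_div, abs_of_pos hpos, abs_mul _ (r ^ k),
          abs_mul _ (r ^ k * r), abs_mul _ r]
        ring
    _ ≤ _ := by gcongr

/-- A sequence with bounded increments grows at most geometrically. -/
theorem exists_abs_le_two_pow {d e : ℕ → ℝ} {l : ℝ} (hd : ∀ k, d (k + 1) = d k + e k)
    (he : Filter.Tendsto e Filter.atTop (nhds l)) : ∃ M, ∀ k, |d k| ≤ M * 2 ^ k := by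
  obtain ⟨M, hM⟩ := (Metric.isBounded_range_of_tendsto e he).exists_norm_le
  refine ⟨max M |d 0|, fun k => ?_⟩
  induction k with
  | zero => simp
  | succ k ih =>
    have h₁ : |e k| ≤ max M |d 0| * 2 ^ k :=
      ((hM _ ⟨k, rfl⟩).trans (le_max_left _ _)).trans
        (le_mul_of_one_le_right ((abs_nonneg _).trans (le_max_right _ _))
          (one_le_pow₀ one_le_two))
    rw [hd, pow_succ]
    linarith [abs_add_le (d k) (e k)]

/-- The logarithmic solution of Kummer's equation `t y'' + (2 - t) y' - a y = 0` on `t > 0`,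
built from any sequence `d` satisfying the recurrence of the digamma differences. -/
theorem kummer_log_solution {a : ℝ} (ha1 : a ≠ 1) (ha : ∀ k : ℕ, a + k ≠ 0) {d : ℕ → ℝ}
    (hd : ∀ k : ℕ, d (k + 1) = d k + (1 / (a + k) - 1 / (1 + k) - 1 / (2 + k))) :
    EntireCoeff (fun k => kummerCoeff a k * d k) ∧
    ∃ y₁ y₂ : ℝ → ℝ, ∀ t, 0 < t →
      HasDerivAt (fun t => powSum (fun k => kummerCoeff a k * d k) t
        + powSum (kummerCoeff a) t * Real.log t + (a - 1)⁻¹ * t⁻¹) (y₁ t) t ∧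
      HasDerivAt y₁ (y₂ t) t ∧
      t * y₂ t + (2 - t) * y₁ t - a * (powSum (fun k => kummerCoeff a k * d k) t
        + powSum (kummerCoeff a) t * Real.log t + (a - 1)⁻¹ * t⁻¹) = 0 := by
  set c := kummerCoeff a
  have hc : EntireCoeff c := entireCoeff_kummerCoeff a
  have hlim (b : ℝ) : Filter.Tendsto (fun k : ℕ => 1 / (b + (k : ℝ))) Filter.atTop (nhds 0) := by
    simp only [one_div]
    exact tendsto_inv_atTop_zero.comp
      (Filter.tendsto_atTop_add_const_left _ b tendsto_natCast_atTop_atTop)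
  obtain ⟨M, hM⟩ := exists_abs_le_two_pow hd (((hlim a).sub (hlim 1)).sub (hlim 2))
  have hq : EntireCoeff fun k => c k * d k := by
    refine hc.of_abs_le M 2 fun k => ?_
    rw [abs_mul]
    nlinarith [hM k, abs_nonneg (c k)]
  refine ⟨hq, ?_⟩
  set q := fun k => c k * d k with hqdef
  refine ⟨fun t => powSum (derivCoeff q) t
      + (powSum (derivCoeff c) t * Real.log t + powSum c t * t⁻¹)
      + (a - 1)⁻¹ * (-(t ^ 2)⁻¹),
    fun t => powSum (derivCoeff (derivCoeff q)) t
      + ((powSum (derivCoeff (derivCoeff c)) t * Real.log t + powSum (derivCoeff c) t * t⁻¹)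
        + (powSum (derivCoeff c) t * t⁻¹ + powSum c t * (-(t ^ 2)⁻¹)))
      + (a - 1)⁻¹ * (2 / t ^ 3), fun t ht => ⟨?_, ?_, ?_⟩⟩
  · exact ((hasDerivAt_powSum hq t).add ((hasDerivAt_powSum hc t).mul
      (Real.hasDerivAt_log ht.ne'))).add ((hasDerivAt_inv ht.ne').const_mul _)
  · have hinv2 : HasDerivAt (fun t : ℝ => -(t ^ 2)⁻¹) (2 / t ^ 3) t := by
      refine ((hasDerivAt_pow 2 t).inv (pow_ne_zero 2 ht.ne')).neg.congr_deriv ?_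
      have := ht.ne'
      field_simp
      norm_num
      ring
    exact ((hasDerivAt_powSum hq.derivCoeff t).add
      (((hasDerivAt_powSum hc.derivCoeff t).mul (Real.hasDerivAt_log ht.ne')).add
      ((hasDerivAt_powSum hc t).mul (hasDerivAt_inv ht.ne')))).add (hinv2.const_mul _)
  · have hA := kummer_powSum hc a t
    have hB := kummer_powSum hq a t
    have hA0 : powSum (fun k => (k + 1) * (k + 2) * c (k + 1) - (k + a) * c k) t = 0 := by
      simp [powSum, c, kummerCoeff_succ]
    have hcoef (k : ℕ) : (k + 1) * (k + 2) * q (k + 1) - (k + a) * q k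
        = c k - 2 * derivCoeff c k - c (k + 1) := by
      have h₁ : (1 + (k : ℝ)) ≠ 0 := by positivity
      have h₂ : (2 + (k : ℝ)) ≠ 0 := by positivity
      have h₃ := ha k
      have hs : c k = (k + 1) * (k + 2) * c (k + 1) / (a + k) := by
        rw [kummerCoeff_succ]
        field_simp
        ring
      simp only [hqdef, derivCoeff, hd]
      rw [hs]
      field_simp
      ring
    have hB0 : powSum (fun k => (k + 1) * (k + 2) * q (k + 1) - (k + a) * q k) t
        = powSum c t - 2 * powSum (derivCoeff c) t - powSum (fun k => c (k + 1)) t := by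
      rw [← (((hc.hasSum t).sub ((hc.derivCoeff.hasSum t).mul_left 2)).sub
        (hc.shift.hasSum t)).tsum_eq]
      exact tsum_congr fun k => by beta_reduce; rw [hcoef]; ring
    have hsh := mul_powSum_shift hc t
    have hc0 : c 0 = 1 := by simp [c, kummerCoeff]
    rw [hc0] at hsh
    have hP : powSum (fun k => c (k + 1)) t = (powSum c t - 1) / t := by
      rw [eq_div_iff ht.ne', ← hsh]; ring
    rw [hA0] at hA
    rw [hB0, hP] at hB
    have ha1' : a - 1 ≠ 0 := sub_ne_zero.2 ha1
    have ht' := ht.ne'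
    have key : t * powSum (derivCoeff (derivCoeff q)) t + (2 - t) * powSum (derivCoeff q) t
        - a * powSum q t - (powSum c t - 2 * powSum (derivCoeff c) t - (powSum c t - 1) / t)
        + Real.log t * (t * powSum (derivCoeff (derivCoeff c)) t
          + (2 - t) * powSum (derivCoeff c) t - a * powSum c t) = 0 := by
      rw [hA, hB]; ring
    rw [← key]
    field_simp
    ring

/-- For `u ∉ ℤ`, the function `θ_u(x) = e^{-|x|/2} ψ_u(x)`, where `ψ_u` is
given by the hypergeometric-type series of Proposition 1, is well defined
(the series converges), twice differentiable on `ℝ \ {0}`, and satisfies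
`x θ_u''(x) + 2 θ_u'(x) + (u - x/4) θ_u(x) = 0` for `x ≠ 0`. -/
theorem theta_u_ode (u : ℝ) (hu : ∀ n : ℤ, u ≠ (n : ℝ))
    (dig : ℝ → ℝ) (hdig : ∀ y : ℝ, dig y = deriv Real.Gamma y / Real.Gamma y)
    (ψ : ℝ → ℝ)
    (hψ : ∀ x : ℝ, ψ x =
      -(u * Real.sin (Real.pi * u) / Real.pi) *
        (∑' k : ℕ,
          ((ascPochhammer ℝ k).eval (1 - u * Real.sign x) * |x| ^ k /
              ((Nat.factorial k : ℝ) * (Nat.factorial (k + 1) : ℝ))) *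
            (dig (1 + (k : ℝ) - u * Real.sign x) - dig (1 + (k : ℝ))
              - dig (2 + (k : ℝ)) + Real.log |x|))
      + Real.sin (Real.pi * u) / (Real.pi * x))
    (θ : ℝ → ℝ) (hθ : ∀ x : ℝ, θ x = Real.exp (-|x| / 2) * ψ x) :
    ∀ x : ℝ, x ≠ 0 →
      Summable (fun k : ℕ =>
        ((ascPochhammer ℝ k).eval (1 - u * Real.sign x) * |x| ^ k /
            ((Nat.factorial k : ℝ) * (Nat.factorial (k + 1) : ℝ))) *
          (dig (1 + (k : ℝ) - u * Real.sign x) - dig (1 + (k : ℝ))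
            - dig (2 + (k : ℝ)) + Real.log |x|)) ∧
      DifferentiableAt ℝ θ x ∧ DifferentiableAt ℝ (deriv θ) x ∧
      x * deriv (deriv θ) x + 2 * deriv θ x + (u - x / 4) * θ x = 0 := by
  intro x hx
  set s := Real.sign x with hsdef
  have hs2 : s * s = 1 := by
    rcases Real.sign_apply_eq_of_ne_zero x hx with h | h <;> rw [hsdef, h] <;> norm_num
  have hs0 : s ≠ 0 := fun h => by simp [h] at hs2
  have hu0 : u ≠ 0 := by simpa using hu 0
  have hsx : s * x = |x| := by
    rcases hx.lt_or_gt with h | h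
    · rw [hsdef, Real.sign_of_neg h, abs_of_neg h]; ring
    · rw [hsdef, Real.sign_of_pos h, abs_of_pos h]; ring
  set a := 1 - u * s with hadef
  have ha (k : ℤ) : a + k ≠ 0 := by
    intro h
    rcases Real.sign_apply_eq_of_ne_zero x hx with h' | h' <;>
      rw [hadef, hsdef, h'] at h
    · exact hu (-1 - k) (by push_cast; linarith)
    · exact hu (1 + k) (by push_cast; linarith)
  have ha1 : a ≠ 1 := by simpa [hadef] using ⟨hu0, hs0⟩
  set d : ℕ → ℝ := fun k => dig (1 + (k : ℝ) - u * s) - dig (1 + (k : ℝ)) - dig (2 + (k : ℝ))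
    with hddef
  have hrec {y : ℝ} (hy : ∀ m : ℕ, y ≠ -m) : dig (y + 1) = dig y + 1 / y := by
    rw [hdig, hdig, logDeriv_Gamma_add_one hy]
  have hd (k : ℕ) : d (k + 1) = d k + (1 / (a + k) - 1 / (1 + k) - 1 / (2 + k)) := by
    have h₁ : dig (a + k + 1) = dig (a + k) + 1 / (a + k) :=
      hrec fun m h => ha (k + m) (by push_cast; linarith)
    have h₂ : dig (1 + k + 1) = dig (1 + k) + 1 / (1 + k : ℝ) :=
      hrec fun m h => by
        have : (0 : ℝ) < 1 + k + m := by positivity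
        linarith
    have h₃ : dig (2 + k + 1) = dig (2 + k) + 1 / (2 + k : ℝ) :=
      hrec fun m h => by
        have : (0 : ℝ) < 2 + k + m := by positivity
        linarith
    simp only [hddef, Nat.cast_add, Nat.cast_one]
    rw [show 1 + ((k : ℝ) + 1) - u * s = a + k + 1 by rw [hadef]; ring,
      show 1 + (k : ℝ) - u * s = a + k by rw [hadef]; ring,
      ← add_assoc, ← add_assoc, h₁, h₂, h₃]
    ring
  obtain ⟨hq, y₁, y₂, hy⟩ := kummer_log_solution ha1 (fun k => ha k) hd
  have hc := entireCoeff_kummerCoeff a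
  have hterm (r : ℝ) : HasSum (fun k : ℕ => ((ascPochhammer ℝ k).eval a * r ^ k /
      ((Nat.factorial k : ℝ) * (Nat.factorial (k + 1) : ℝ))) *
        (dig (1 + (k : ℝ) - u * s) - dig (1 + (k : ℝ)) - dig (2 + (k : ℝ)) + Real.log r))
      (powSum (fun k => kummerCoeff a k * d k) r + powSum (kummerCoeff a) r * Real.log r) := by
    convert (hq.hasSum r).add ((hc.hasSum r).mul_right (Real.log r)) using 2 with k
    simp only [kummerCoeff, hddef]
    ring
  refine ⟨(hterm |x|).summable, ?_⟩
  set y : ℝ → ℝ := fun t => powSum (fun k => kummerCoeff a k * d k) t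
    + powSum (kummerCoeff a) t * Real.log t + (a - 1)⁻¹ * t⁻¹ with hydef
  set κ := -(u * Real.sin (Real.pi * u) / Real.pi) with hκ
  have hopen : IsOpen {z : ℝ | 0 < s * z} := isOpen_lt continuous_const (by fun_prop)
  have hmem : 0 < s * x := by rw [hsx]; exact abs_pos.2 hx
  have hθeq (z : ℝ) (hz : 0 < s * z) :
      θ z = κ * (Real.exp (-(s * z) / 2) * y (s * z)) := by
    have hz0 : z ≠ 0 := by rintro rfl; simp at hz
    have hsz : Real.sign z = s := by
      rcases Real.sign_apply_eq_of_ne_zero x hx with h | h <;> rw [hsdef, h] at hz ⊢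
      · exact Real.sign_of_neg (by linarith)
      · exact Real.sign_of_pos (by linarith)
    have hzabs : |z| = s * z := by
      rw [← abs_of_pos hz, abs_mul]
      rcases Real.sign_apply_eq_of_ne_zero x hx with h | h <;> rw [hsdef, h] <;> simp
    have hpi := Real.pi_ne_zero
    rw [hθ, hψ, hsz, hzabs, (hterm (s * z)).tsum_eq]
    simp only [hydef]
    have e : Real.sin (Real.pi * u) / (Real.pi * z) = κ * ((a - 1)⁻¹ * (s * z)⁻¹) := by
      rw [← mul_inv, show (a - 1) * (s * z) = -(u * z) by
        rw [hadef]; linear_combination (-u * z) * hs2, hκ]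
      field_simp
    rw [e]
    ring
  have hlin (z : ℝ) : HasDerivAt (fun z => s * z) s z := by
    simpa using (hasDerivAt_id z).const_mul s
  have hexp (z : ℝ) : HasDerivAt (fun z => Real.exp (-(s * z) / 2))
      (Real.exp (-(s * z) / 2) * (-s / 2)) z := ((hlin z).neg.div_const 2).exp
  have hθ₁ (z : ℝ) (hz : 0 < s * z) : HasDerivAt θ
      (κ * (Real.exp (-(s * z) / 2) * (-s / 2) * y (s * z)
        + Real.exp (-(s * z) / 2) * (y₁ (s * z) * s))) z := by
    refine (((hexp z).mul ((hy _ hz).1.comp z (hlin z))).const_mul κ).congr_of_eventuallyEq ?_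
    filter_upwards [hopen.mem_nhds hz] with w hw using hθeq w hw
  have hθ₂ : HasDerivAt (deriv θ) (κ * ((Real.exp (-(s * x) / 2) * (-s / 2) * (-s / 2) * y (s * x)
        + Real.exp (-(s * x) / 2) * (-s / 2) * (y₁ (s * x) * s))
        + (Real.exp (-(s * x) / 2) * (-s / 2) * (y₁ (s * x) * s)
          + Real.exp (-(s * x) / 2) * (y₂ (s * x) * s * s)))) x := by
    refine (((((hexp x).mul_const (-s / 2)).mul ((hy _ hmem).1.comp x (hlin x))).add
      ((hexp x).mul (((hy _ hmem).2.1.comp x (hlin x)).mul_const s))).const_mul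
        κ).congr_of_eventuallyEq ?_
    filter_upwards [hopen.mem_nhds hmem] with w hw using (hθ₁ w hw).deriv
  refine ⟨(hθ₁ x hmem).differentiableAt, hθ₂.differentiableAt, ?_⟩
  rw [hθ₂.deriv, (hθ₁ x hmem).deriv, hθeq x hmem]
  have hode : s * x * y₂ (s * x) + (2 - s * x) * y₁ (s * x) - a * y (s * x) = 0 := (hy _ hmem).2.2
  rw [hadef] at hode
  generalize Real.exp (-(s * x) / 2) = E, y (s * x) = Y, y₁ (s * x) = Y₁, y₂ (s * x) = Y₂ at *
  have hs3 : s ^ 2 = 1 := by rw [pow_two, hs2]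
  linear_combination (κ * E * s) * hode
    + κ * E * (x * Y / 4 - u * Y) * hs3
end

section
/- Define K : ℝ × ℝ → ℂ by K(w, r) = (2/π) ∫_ℝ exp( i·( rλ + 2w·arctan(2λ) ) ) / (1 + 4λ²) dλ. Then there exists a constant C < ∞ such that for all w ∈ ℝ and all r ≠ 0: |1 − K(w, r)| ≤ C·( |w| + |r|·( 1 + log(1 + 1/r²) ) ), and |1 − K(w, 0)| ≤ C·|w|. -/
open MeasureTheory

lemma integrable_inv_one_add_four_mul_sq :
    Integrable fun x : ℝ => (1 + 4 * x ^ 2)⁻¹ := by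
  have h := integrable_inv_one_add_sq.comp_mul_left' (show (2 : ℝ) ≠ 0 by norm_num)
  refine h.congr (Filter.Eventually.of_forall fun x => ?_)
  simp only
  ring_nf

lemma integral_inv_one_add_four_mul_sq :
    ∫ x : ℝ, (1 + 4 * x ^ 2)⁻¹ = Real.pi / 2 := by
  have h := Measure.integral_comp_mul_left (fun x : ℝ => (1 + x ^ 2)⁻¹) 2
  rw [integral_univ_inv_one_add_sq] at h
  have e : ∀ x : ℝ, (1 + 4 * x ^ 2)⁻¹ = (1 + (2 * x) ^ 2)⁻¹ := fun x => by ring_nf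
  simp_rw [e]
  rw [h, abs_of_pos (by norm_num), smul_eq_mul]
  ring

lemma integrable_min_two_div (r : ℝ) :
    Integrable fun x : ℝ => min 2 (|r| * |x|) / (1 + 4 * x ^ 2) := by
  refine (integrable_inv_one_add_four_mul_sq.const_mul 2).mono'
    (Measurable.aestronglyMeasurable (by fun_prop)) (Filter.Eventually.of_forall fun x => ?_)
  rw [Real.norm_of_nonneg (by positivity), div_eq_mul_inv]
  gcongr
  exact min_le_left _ _

lemma intervalIntegral_mul_div_one_add_four_mul_sq (R : ℝ) :
    ∫ x in (0 : ℝ)..R, x / (1 + 4 * x ^ 2) = Real.log (1 + 4 * R ^ 2) / 8 := by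
  have hpos : ∀ x : ℝ, 1 + 4 * x ^ 2 ≠ 0 := fun x => by positivity
  rw [intervalIntegral.integral_eq_sub_of_hasDerivAt
    (f := fun x : ℝ => Real.log (1 + 4 * x ^ 2) / 8)]
  · simp
  · intro x _
    have h := ((((hasDerivAt_pow 2 x).const_mul 4).const_add 1).log (hpos x)).div_const 8
    refine h.congr_deriv ?_
    push_cast
    ring
  · exact (continuous_id.div (by fun_prop) hpos).intervalIntegrable _ _

/-- Splitting the integral at `|x| = 1 / |r|`. -/
lemma integral_min_two_div_le {r : ℝ} (hr : r ≠ 0) :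
    ∫ x : ℝ, min 2 (|r| * |x|) / (1 + 4 * x ^ 2) ≤
      |r| * (1 + Real.log (1 + 1 / r ^ 2)) := by
  have hr' : 0 < |r| := abs_pos.2 hr
  set R : ℝ := |r|⁻¹ with hR
  have hRpos : 0 < R := by positivity
  have hint := integrable_min_two_div r
  have heven : ∫ x : ℝ, min 2 (|r| * |x|) / (1 + 4 * x ^ 2) =
      2 * ∫ x in Set.Ioi (0 : ℝ), min 2 (|r| * |x|) / (1 + 4 * x ^ 2) := by
    have h := integral_comp_abs (f := fun x : ℝ => min 2 (|r| * |x|) / (1 + 4 * x ^ 2))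
    simpa only [abs_abs, sq_abs] using h
  have hsplit : ∫ x in Set.Ioi (0 : ℝ), min 2 (|r| * |x|) / (1 + 4 * x ^ 2) =
      (∫ x in Set.Ioc 0 R, min 2 (|r| * |x|) / (1 + 4 * x ^ 2)) +
        ∫ x in Set.Ioi R, min 2 (|r| * |x|) / (1 + 4 * x ^ 2) := by
    rw [← Set.Ioc_union_Ioi_eq_Ioi hRpos.le]
    exact setIntegral_union (Set.Ioc_disjoint_Ioi le_rfl) measurableSet_Ioi
      hint.integrableOn hint.integrableOn
  have hnear : ∫ x in Set.Ioc 0 R, min 2 (|r| * |x|) / (1 + 4 * x ^ 2) ≤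
      |r| * (Real.log (1 + 4 * R ^ 2) / 8) := by
    rw [← intervalIntegral_mul_div_one_add_four_mul_sq, intervalIntegral.integral_of_le hRpos.le,
      ← integral_const_mul]
    refine setIntegral_mono_on hint.integrableOn ?_ measurableSet_Ioc fun x hx => ?_
    · refine (Continuous.integrableOn_Ioc ?_)
      exact continuous_const.mul
        (continuous_id.div (by fun_prop) fun x => by positivity)
    · rw [abs_of_pos hx.1, ← mul_div_assoc]
      gcongr
      exact min_le_right _ _
  have hfar : ∫ x in Set.Ioi R, min 2 (|r| * |x|) / (1 + 4 * x ^ 2) ≤ |r| / 2 := by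
    have hpow : ∫ x in Set.Ioi R, (1 / 2 : ℝ) * x ^ (-2 : ℝ) = |r| / 2 := by
      rw [integral_const_mul, integral_Ioi_rpow_of_lt (by norm_num) hRpos]
      norm_num
      rw [Real.rpow_neg_one, hR, inv_inv]
      ring
    rw [← hpow]
    refine setIntegral_mono_on hint.integrableOn
      ((integrableOn_Ioi_rpow_of_lt (by norm_num) hRpos).const_mul _) measurableSet_Ioi
      fun x hx => ?_
    have hx0 : 0 < x := hRpos.trans hx
    rw [Real.rpow_neg hx0.le, Real.rpow_two]
    calc min 2 (|r| * |x|) / (1 + 4 * x ^ 2) ≤ 2 / (4 * x ^ 2) := by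
          gcongr
          · exact min_le_left _ _
          · linarith
      _ = 1 / 2 * (x ^ 2)⁻¹ := by field_simp; norm_num
  have hlog : Real.log (1 + 4 * R ^ 2) ≤ 4 * Real.log (1 + 1 / r ^ 2) := by
    have hR2 : R ^ 2 = 1 / r ^ 2 := by rw [hR, inv_pow, sq_abs, one_div]
    have hb := one_add_mul_le_pow (a := 1 / r ^ 2)
      (by have : 0 ≤ 1 / r ^ 2 := by positivity
          linarith) 4
    have h4 : Real.log ((1 + 1 / r ^ 2) ^ 4) = (4 : ℕ) * Real.log (1 + 1 / r ^ 2) :=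
      Real.log_pow ..
    push_cast at hb h4
    rw [← h4, hR2]
    exact Real.log_le_log (by positivity) hb
  rw [heven, hsplit]
  have := mul_le_mul_of_nonneg_left hlog hr'.le
  linarith

lemma norm_one_sub_exp_I_mul_le (a b : ℝ) :
    ‖1 - Complex.exp (Complex.I * ((a + b : ℝ) : ℂ))‖ ≤ min 2 |a| + |b| := by
  rw [norm_sub_rev, min_add]
  refine le_min ?_ ?_
  · calc ‖Complex.exp (Complex.I * ((a + b : ℝ) : ℂ)) - 1‖
        ≤ ‖Complex.exp (Complex.I * ((a + b : ℝ) : ℂ))‖ + ‖(1 : ℂ)‖ := norm_sub_le _ _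
      _ = 2 := by rw [mul_comm, Complex.norm_exp_ofReal_mul_I]; norm_num
      _ ≤ 2 + |b| := by linarith [abs_nonneg b]
  · exact Real.norm_exp_I_mul_ofReal_sub_one_le.trans (abs_add_le a b)

lemma norm_one_sub_covariance_le (w r : ℝ) :
    ‖1 - (2 / Real.pi : ℂ) *
      ∫ l : ℝ, Complex.exp (Complex.I * (r * l + 2 * w * Real.arctan (2 * l))) /
        ((1 : ℂ) + 4 * (l : ℂ) ^ 2)‖ ≤
      2 / Real.pi * (∫ x : ℝ, min 2 (|r| * |x|) / (1 + 4 * x ^ 2)) + Real.pi * |w| := by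
  have hpi := Real.pi_pos
  let g : ℝ → ℂ := fun l =>
    Complex.exp (Complex.I * ((r * l + 2 * w * Real.arctan (2 * l) : ℝ) : ℂ))
  let d : ℝ → ℝ := fun l => (1 + 4 * l ^ 2)⁻¹
  have hd : Integrable d := integrable_inv_one_add_four_mul_sq
  have hdC : Integrable fun l => (d l : ℂ) := hd.ofReal
  have hgc : Continuous g := by
    have := Real.continuous_arctan
    fun_prop
  have hgd : Integrable fun l => g l * (d l : ℂ) := by
    refine hdC.bdd_mul (c := 1) hgc.aestronglyMeasurable (Filter.Eventually.of_forall fun l => ?_)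
    simp only [g]
    rw [mul_comm, Complex.norm_exp_ofReal_mul_I]
  have hform : ∀ l : ℝ, Complex.exp (Complex.I * (r * l + 2 * w * Real.arctan (2 * l))) /
      ((1 : ℂ) + 4 * (l : ℂ) ^ 2) = g l * (d l : ℂ) := fun l => by
    simp only [g, d]
    push_cast
    rw [div_eq_mul_inv]
  have hone : (1 : ℂ) = (2 / Real.pi : ℂ) * ∫ l : ℝ, (d l : ℂ) := by
    rw [integral_complex_ofReal, integral_inv_one_add_four_mul_sq]
    have : (Real.pi : ℂ) ≠ 0 := by exact_mod_cast hpi.ne'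
    push_cast
    field_simp
  simp_rw [hform]
  nth_rewrite 1 [hone]
  rw [← mul_sub, ← integral_sub hdC hgd, norm_mul]
  have hc : ‖(2 / Real.pi : ℂ)‖ = 2 / Real.pi := by
    rw [norm_div, Complex.norm_real, Real.norm_of_nonneg hpi.le]
    norm_num
  have hmin := integrable_min_two_div r
  have hbound : ‖∫ l : ℝ, ((d l : ℂ) - g l * (d l : ℂ))‖ ≤
      ∫ l : ℝ, (min 2 (|r| * |l|) / (1 + 4 * l ^ 2) + Real.pi * |w| * d l) := by
    refine norm_integral_le_of_norm_le (hmin.add (hd.const_mul _))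
      (Filter.Eventually.of_forall fun l => ?_)
    have hd0 : 0 ≤ d l := by simp only [d]; positivity
    have hatan : |2 * w * Real.arctan (2 * l)| ≤ Real.pi * |w| := by
      have h := (abs_lt.2 ⟨Real.neg_pi_div_two_lt_arctan (2 * l),
        Real.arctan_lt_pi_div_two (2 * l)⟩).le
      rw [abs_mul, abs_mul, abs_two]
      nlinarith [mul_le_mul_of_nonneg_left h (abs_nonneg w)]
    have h := norm_one_sub_exp_I_mul_le (r * l) (2 * w * Real.arctan (2 * l))
    rw [abs_mul r l] at h
    calc ‖(d l : ℂ) - g l * (d l : ℂ)‖ = ‖1 - g l‖ * d l := by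
          rw [← one_sub_mul, norm_mul, Complex.norm_real, Real.norm_of_nonneg hd0]
      _ ≤ (min 2 (|r| * |l|) + Real.pi * |w|) * d l := by
          gcongr
          exact h.trans (by gcongr)
      _ = min 2 (|r| * |l|) / (1 + 4 * l ^ 2) + Real.pi * |w| * d l := by
          rw [add_mul, div_eq_mul_inv]
  rw [integral_add hmin (hd.const_mul _), integral_const_mul,
    integral_inv_one_add_four_mul_sq] at hbound
  rw [hc]
  refine (mul_le_mul_of_nonneg_left hbound (by positivity)).trans (le_of_eq ?_)
  field_simp

/-- Kolmogorov-type continuity estimate for the covariance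
`K(w,r) = (2/π) ∫_ℝ e^{i(rλ + 2w arctan(2λ))}/(1+4λ²) dλ` of the
two-parameter gaussian family: there is `C < ∞` with
`|1 - K(w,r)| ≤ C (|w| + |r|(1 + log(1 + 1/r²)))` for `r ≠ 0`, and
`|1 - K(w,0)| ≤ C |w|`. -/
theorem covariance_continuity_estimate
    (K : ℝ → ℝ → ℂ)
    (hK : ∀ w r : ℝ, K w r = (2 / Real.pi) *
      ∫ l : ℝ, Complex.exp (Complex.I * (r * l + 2 * w * Real.arctan (2 * l))) /
        ((1 : ℂ) + 4 * (l : ℂ) ^ 2)) :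
    ∃ C : ℝ, (∀ w r : ℝ, r ≠ 0 →
        ‖1 - K w r‖ ≤ C * (|w| + |r| * (1 + Real.log (1 + 1 / r ^ 2)))) ∧
      (∀ w : ℝ, ‖1 - K w 0‖ ≤ C * |w|) := by
  have hpi := Real.pi_gt_three
  refine ⟨Real.pi, fun w r hr => ?_, fun w => ?_⟩
  · rw [hK]
    refine (norm_one_sub_covariance_le w r).trans ?_
    have hle := integral_min_two_div_le hr
    have hnonneg : 0 ≤ ∫ x : ℝ, min 2 (|r| * |x|) / (1 + 4 * x ^ 2) :=
      integral_nonneg fun x => by positivity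
    have hcoef : 2 / Real.pi ≤ Real.pi := by
      rw [div_le_iff₀ (by linarith)]
      nlinarith
    have := mul_le_mul hcoef hle hnonneg (by linarith)
    linarith
  · rw [hK]
    simpa using norm_one_sub_covariance_le w 0
end
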